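/- arXiv:2601.20588 — 5 statements merged into one kernel-verified Lean document; each statement's English description precedes it below -/
import Mathlib

section
/- For every real α > 0 there exists N ∈ ℕ such that for every natural number g ≥ N, with k = 2·⌊(1/2)·((3/4)·α·log(g) − 1)⌋ + 1, p = ⌊4g/(3·α·log(g))⌋ + 2 and q = 2k, one has (p − 1)·(q − 1) ≤ 2g − 4g/(3·α·log(g)) + (3/2)·α·log(g) − 1 < 2g − 2. -/
open Real

/-- Any constant multiple of `(log n) ^ 2` is eventually smaller than `n`. -/
lemma eventually_const_mul_log_sq_lt {c : ℝ} (hc : 0 < c) :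
    ∀ᶠ n : ℕ in Filter.atTop, c * Real.log n ^ 2 < n := by
  have h := (Real.isLittleO_pow_log_id_atTop (n := 2)).bound
    (show (0 : ℝ) < 1 / (2 * c) by positivity)
  filter_upwards [tendsto_natCast_atTop_atTop.eventually h, Filter.eventually_gt_atTop 0]
    with n hn hpos
  have hn0 : (0 : ℝ) < n := by exact_mod_cast hpos
  simp only [id, Real.norm_eq_abs, abs_of_pos hn0, abs_of_nonneg (sq_nonneg (Real.log n))] at hn
  calc c * Real.log n ^ 2 ≤ c * (1 / (2 * c) * n) := by gcongr
    _ = n / 2 := by field_simp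
    _ < n := by linarith

/-- For every real `α > 0` there exists `N ∈ ℕ` such that for every natural `g ≥ N`, with
`k = 2⌊(1/2)((3/4) α log g − 1)⌋ + 1`, `p = ⌊4g/(3 α log g)⌋ + 2` and `q = 2k`, one has
`(p − 1)(q − 1) ≤ 2g − 4g/(3 α log g) + (3/2) α log g − 1 < 2g − 2`. -/
theorem euler_characteristic_bound (α : ℝ) (hα : 0 < α) :
    ∃ N : ℕ, ∀ g : ℕ, N ≤ g →
      ∀ k p q : ℤ,
        k = 2 * ⌊(1 / 2 : ℝ) * ((3 / 4) * α * Real.log g - 1)⌋ + 1 →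
        p = ⌊4 * (g : ℝ) / (3 * α * Real.log g)⌋ + 2 →
        q = 2 * k →
        ((p : ℝ) - 1) * ((q : ℝ) - 1) ≤
            2 * (g : ℝ) - 4 * (g : ℝ) / (3 * α * Real.log g) +
              (3 / 2) * α * Real.log g - 1 ∧
          2 * (g : ℝ) - 4 * (g : ℝ) / (3 * α * Real.log g) +
              (3 / 2) * α * Real.log g - 1 < 2 * (g : ℝ) - 2 := by
  have hlog : Filter.Tendsto (fun n : ℕ => (3 / 4) * α * Real.log n) Filter.atTop Filter.atTop :=
    (Real.tendsto_log_atTop.comp tendsto_natCast_atTop_atTop).const_mul_atTop (by positivity)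
  obtain ⟨N, hN⟩ := Filter.eventually_atTop.1 ((hlog.eventually_ge_atTop 1).and
    (eventually_const_mul_log_sq_lt (show 0 < 3 * ((3 / 4) * α) ^ 2 by positivity)))
  refine ⟨N, fun g hg k p q hk hp hq => ?_⟩
  obtain ⟨hL, hsq⟩ := hN g hg
  set L := (3 / 4) * α * Real.log g with hLdef
  have hL0 : 0 < L := by linarith
  have hx : 4 * (g : ℝ) / (3 * α * Real.log g) = g / L := by
    rw [show 3 * α * Real.log g = 4 * L by rw [hLdef]; ring]
    exact mul_div_mul_left _ _ (by norm_num)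
  have hlin : (3 / 2) * α * Real.log g = 2 * L := by rw [hLdef]; ring
  rw [hx] at hp
  rw [hx, hlin]
  have hmul : g / L * L = g := div_mul_cancel₀ _ hL0.ne'
  have hx0 : 0 ≤ g / L := by positivity
  constructor
  · have hk' : (k : ℝ) ≤ L := by
      rw [hk]
      push_cast
      linarith [Int.floor_le ((1 / 2 : ℝ) * (L - 1))]
    have hp' : (p : ℝ) - 1 ≤ g / L + 1 := by
      rw [hp]
      push_cast
      linarith [Int.floor_le (g / L)]
    have hp0 : (0 : ℝ) ≤ (p : ℝ) - 1 := by
      have : (0 : ℝ) ≤ ⌊g / L⌋ := by exact_mod_cast Int.floor_nonneg.2 hx0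
      rw [hp]
      push_cast
      linarith
    have hq' : (q : ℝ) - 1 ≤ 2 * L - 1 := by
      rw [hq]
      push_cast
      linarith
    calc ((p : ℝ) - 1) * ((q : ℝ) - 1) ≤ (g / L + 1) * (2 * L - 1) :=
          (mul_le_mul_of_nonneg_left hq' hp0).trans
            (mul_le_mul_of_nonneg_right hp' (by linarith))
      _ = 2 * (g / L * L) - g / L + 2 * L - 1 := by ring
      _ = 2 * g - g / L + 2 * L - 1 := by rw [hmul]
  · have hbound : 3 * L < g / L := by
      rw [lt_div_iff₀ hL0]
      calc 3 * L * L = 3 * ((3 / 4) * α) ^ 2 * Real.log g ^ 2 := by rw [hLdef]; ring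
        _ < g := hsq
    linarith
end

section
/- For every natural number k ≥ 1, the central binomial coefficient satisfies C(2k, k) ≥ (7/(8·√π)) · 4^k / √k, as an inequality of real numbers. -/
open Real

theorem centralBinom_sq_mul_wallis (k : ℕ) :
    (Nat.centralBinom k : ℝ) ^ 2 * (2 * k + 1) * Wallis.W k = 16 ^ k := by
  induction k with
  | zero => simp [Wallis.W]
  | succ k ih =>
    have hrec : ((k : ℝ) + 1) * Nat.centralBinom (k + 1) =
        2 * (2 * k + 1) * Nat.centralBinom k := by
      exact_mod_cast Nat.succ_mul_centralBinom_succ k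
    have hc : (Nat.centralBinom (k + 1) : ℝ) =
        2 * (2 * k + 1) * Nat.centralBinom k / (k + 1) := by
      rw [eq_div_iff (by positivity), ← hrec, mul_comm]
    rw [Wallis.W_succ, pow_succ (16 : ℝ), ← ih, hc]
    push_cast
    field_simp
    ring

theorem two_mul_sixteen_pow_le_pi_mul_centralBinom_sq (k : ℕ) :
    2 * 16 ^ k ≤ π * (2 * k + 1) * (Nat.centralBinom k : ℝ) ^ 2 := by
  have h := mul_le_mul_of_nonneg_left (Wallis.W_le k)
    (by positivity : (0 : ℝ) ≤ (Nat.centralBinom k : ℝ) ^ 2 * (2 * k + 1))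
  rw [centralBinom_sq_mul_wallis] at h
  linarith

/-- For every natural `k ≥ 1`, the central binomial coefficient satisfies
`C(2k, k) ≥ (7/(8√π)) · 4^k / √k`. -/
theorem centralBinom_lower_bound (k : ℕ) (hk : 1 ≤ k) :
    (Nat.centralBinom k : ℝ) ≥ (7 / (8 * Real.sqrt π)) * 4 ^ k / Real.sqrt k := by
  have hk0 : (0 : ℝ) < k := by exact_mod_cast hk
  have key : 49 * 16 ^ k ≤ 64 * (π * k) * (Nat.centralBinom k : ℝ) ^ 2 := by
    obtain rfl | hk2 := hk.eq_or_lt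
    · norm_num [Nat.centralBinom, Nat.choose]
      linarith [pi_gt_d2]
    · have hk2' : (2 : ℝ) ≤ k := by exact_mod_cast hk2
      have hle : 49 * (2 * (k : ℝ) + 1) ≤ 128 * k := by linarith
      have h := mul_le_mul_of_nonneg_right hle
        (by positivity : (0 : ℝ) ≤ π * (Nat.centralBinom k : ℝ) ^ 2)
      linarith [two_mul_sixteen_pow_le_pi_mul_centralBinom_sq k]
  refine (sq_le_sq₀ (by positivity) (Nat.cast_nonneg _)).1 ?_
  have hsq : (7 / (8 * √π) * 4 ^ k / √k) ^ 2 = 49 * 16 ^ k / (64 * (π * k)) := by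
    rw [div_pow, mul_pow, div_pow, mul_pow, sq_sqrt pi_pos.le, sq_sqrt hk0.le, ← pow_mul,
      mul_comm k 2, pow_mul]
    field_simp
    norm_num
    ring
  rw [hsq, div_le_iff₀ (by positivity)]
  linarith
end

section
/- Let α > 0 be real and set c' = 7/(64·√(3π)). There exists N ∈ ℕ such that for every natural number g ≥ N, with k = 2·⌊(1/2)·((3/4)·α·log(g) − 1)⌋ + 1 and p = ⌊4g/(3·α·log(g))⌋ + 2, the number m(p,q) = (p − 1)·C(2k, k) satisfies (p − 1)·C(2k, k) ≥ (4c'/3) · g^{1 + (3/4)·log(4)·α} / (α·log(g))^{3/2}, as real numbers. -/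
open Real

lemma sixteen_pow_le_four_mul_self_mul_centralBinom_sq {n : ℕ} (hn : 1 ≤ n) :
    16 ^ n ≤ 4 * n * n.centralBinom ^ 2 := by
  induction n, hn using Nat.le_induction with
  | base => simp [Nat.centralBinom, Nat.choose]
  | succ n hn ih =>
    have h := Nat.succ_mul_centralBinom_succ n
    refine Nat.le_of_mul_le_mul_left (c := n + 1) ?_ n.succ_pos
    calc (n + 1) * 16 ^ (n + 1) = 16 * (n + 1) * 16 ^ n := by ring
      _ ≤ 16 * (n + 1) * (4 * n * n.centralBinom ^ 2) := by gcongr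
      _ = 16 * (4 * n * (n + 1)) * n.centralBinom ^ 2 := by ring
      _ ≤ 16 * (2 * n + 1) ^ 2 * n.centralBinom ^ 2 := by gcongr; nlinarith
      _ = 4 * (2 * (2 * n + 1) * n.centralBinom) ^ 2 := by ring
      _ = (n + 1) * (4 * (n + 1) * (n + 1).centralBinom ^ 2) := by rw [← h]; ring

lemma four_pow_div_two_mul_sqrt_le_centralBinom {n : ℕ} (hn : 1 ≤ n) :
    (4 : ℝ) ^ n / (2 * √n) ≤ n.centralBinom := by
  have hn' : (0 : ℝ) < n := by exact_mod_cast hn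
  have h : (16 : ℝ) ^ n ≤ 4 * n * (n.centralBinom : ℝ) ^ 2 := by
    exact_mod_cast sixteen_pow_le_four_mul_self_mul_centralBinom_sq hn
  rw [div_le_iff₀ (by positivity)]
  refine (sq_le_sq₀ (by positivity) (by positivity)).1 ?_
  calc ((4 : ℝ) ^ n) ^ 2 = 16 ^ n := by rw [← pow_mul, mul_comm, pow_mul]; norm_num
    _ ≤ 4 * n * (n.centralBinom : ℝ) ^ 2 := h
    _ = (n.centralBinom * (2 * √n)) ^ 2 := by rw [mul_pow, mul_pow, sq_sqrt hn'.le]; ring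

lemma four_rpow_div_le_centralBinom {x : ℝ} {n : ℕ} (hn : 1 ≤ n) (hnx : n ≤ x)
    (hxn : x - 2 ≤ n) : (4 : ℝ) ^ x / (32 * √x) ≤ n.centralBinom := by
  have hn' : (0 : ℝ) < n := by exact_mod_cast hn
  have hpow : (4 : ℝ) ^ x / 16 ≤ 4 ^ n := by
    rw [← rpow_natCast]
    calc (4 : ℝ) ^ x / 16 = 4 ^ (x - 2) := by rw [rpow_sub (by norm_num)]; norm_num
      _ ≤ 4 ^ (n : ℝ) := rpow_le_rpow_of_exponent_le (by norm_num) hxn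
  calc (4 : ℝ) ^ x / (32 * √x) = (4 ^ x / 16) / (2 * √x) := by
        rw [div_div]; congr 1; ring
    _ ≤ 4 ^ n / (2 * √n) := by gcongr
    _ ≤ n.centralBinom := four_pow_div_two_mul_sqrt_le_centralBinom hn

/-- Let `α > 0` and `c' = 7/(64√(3π))`. There exists `N ∈ ℕ` such that for every natural
`g ≥ N`, with `k = 2⌊(1/2)((3/4) α log g − 1)⌋ + 1` and `p = ⌊4g/(3 α log g)⌋ + 2`, the
number of curves `m(p,q) = (p − 1)·C(2k, k)` satisfies
`(p − 1)·C(2k, k) ≥ (4c'/3) · g^(1 + (3/4)·log 4·α) / (α log g)^(3/2)`. -/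
theorem number_of_curves_lower_bound (α : ℝ) (hα : 0 < α)
    (c' : ℝ) (hc' : c' = 7 / (64 * Real.sqrt (3 * π))) :
    ∃ N : ℕ, ∀ g : ℕ, N ≤ g →
      ∀ k p : ℤ,
        k = 2 * ⌊(1 / 2 : ℝ) * ((3 / 4) * α * Real.log g - 1)⌋ + 1 →
        p = ⌊4 * (g : ℝ) / (3 * α * Real.log g)⌋ + 2 →
        ((p : ℝ) - 1) * (Nat.centralBinom k.toNat : ℝ) ≥
          (4 * c' / 3) * (g : ℝ) ^ (1 + (3 / 4) * Real.log 4 * α) /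
            (α * Real.log g) ^ (3 / 2 : ℝ) := by
  refine ⟨max 1 ⌈exp (4 / (3 * α))⌉₊, fun g hg k p hk hp => ?_⟩
  have hg0 : (0 : ℝ) < g := by exact_mod_cast (le_max_left _ _).trans hg
  have hlog : 4 / (3 * α) ≤ log g :=
    (le_log_iff_exp_le hg0).2 (Nat.ceil_le.1 ((le_max_right _ _).trans hg))
  obtain ⟨L, hL⟩ : ∃ L, L = α * log g := ⟨_, rfl⟩
  have hL1 : 1 ≤ 3 / 4 * L := by
    rw [div_le_iff₀ (by positivity)] at hlog
    linarith
  have hL0 : 0 < L := by linarith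
  rw [show (1 / 2 : ℝ) * (3 / 4 * α * log g - 1) = (3 / 4 * L - 1) / 2 by rw [hL]; ring] at hk
  rw [show 3 * α * log g = 3 * L by rw [hL]; ring] at hp
  have hk1 : 1 ≤ k := by
    have : 0 ≤ ⌊(3 / 4 * L - 1) / 2⌋ := Int.floor_nonneg.2 (by linarith)
    omega
  lift k to ℕ using by omega
  have hkR : (k : ℝ) = 2 * (⌊(3 / 4 * L - 1) / 2⌋ : ℝ) + 1 := by exact_mod_cast hk
  have hfl := Int.floor_le ((3 / 4 * L - 1) / 2)
  have hfl' := Int.lt_floor_add_one ((3 / 4 * L - 1) / 2)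
  have hbinom := four_rpow_div_le_centralBinom (x := 3 / 4 * L) (n := k)
    (by exact_mod_cast hk1) (by linarith) (by linarith)
  have hp' : 4 * (g : ℝ) / (3 * L) ≤ p - 1 := by
    have := Int.lt_floor_add_one (4 * (g : ℝ) / (3 * L))
    rw [hp]
    push_cast
    linarith
  have hgpow : (g : ℝ) ^ (1 + 3 / 4 * log 4 * α) = g * 4 ^ (3 / 4 * L) := by
    rw [rpow_add hg0, rpow_one, rpow_def_of_pos hg0, rpow_def_of_pos (by norm_num), hL]
    ring_nf
  have hLpow : L ^ (3 / 2 : ℝ) = L * √L := by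
    rw [show (3 / 2 : ℝ) = 1 + 1 / 2 by norm_num, rpow_add hL0, rpow_one, sqrt_eq_rpow]
  have hsqrt : √(3 / 4 * L) = √3 * √L / 2 := by
    rw [show 3 / 4 * L = 3 * L / 2 ^ 2 by ring, sqrt_div (by positivity),
      sqrt_mul (by norm_num), sqrt_sq (by norm_num)]
  have hpi : 7 / 4 ≤ √π := le_sqrt_of_sq_le (by linarith [pi_gt_d2])
  rw [← hL, hgpow, hLpow, hc', Int.toNat_natCast, sqrt_mul (by norm_num)]
  calc 4 * (7 / (64 * (√3 * √π))) / 3 * (g * 4 ^ (3 / 4 * L)) / (L * √L)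
      = 7 / 4 * (g * 4 ^ (3 / 4 * L) / (12 * L * √3 * √L)) / √π := by field_simp; norm_num
    _ ≤ √π * (g * 4 ^ (3 / 4 * L) / (12 * L * √3 * √L)) / √π := by gcongr
    _ = 4 * g / (3 * L) * (4 ^ (3 / 4 * L) / (32 * √(3 / 4 * L))) := by
        rw [hsqrt]; field_simp; norm_num
    _ ≤ (p - 1) * k.centralBinom := by
        have : (0 : ℝ) ≤ 4 * g / (3 * L) := by positivity
        exact mul_le_mul hp' hbinom (by positivity) (this.trans hp')
end

section
/- For every real α > 0 there exists N ∈ ℕ such that for every natural number g ≥ N, with k = 2·⌊(1/2)·((3/4)·α·log(g) − 1)⌋ + 1 and p = ⌊4g/(3·α·log(g))⌋ + 2, one has (p − 1)·C(2k, k) > g^{1+α}, as an inequality of real numbers. -/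
theorem eventually_sq_mul_exp_le_four_rpow :
    ∀ᶠ x : ℝ in Filter.atTop, 16 * x ^ 2 * Real.exp (4 / 3 * x) ≤ (4 : ℝ) ^ x := by
  have hlog : Real.log 4 = 2 * Real.log 2 := by
    rw [show (4 : ℝ) = 2 ^ 2 by norm_num, Real.log_pow]
    norm_num
  have hc : 0 < Real.log 4 - 4 / 3 := by
    linarith [Real.log_two_gt_d9]
  filter_upwards [(isLittleO_pow_exp_pos_mul_atTop 2 hc).bound
    (show (0 : ℝ) < 1 / 16 by norm_num)] with x hx
  rw [Real.norm_of_nonneg (by positivity), Real.norm_of_nonneg (by positivity)] at hx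
  calc 16 * x ^ 2 * Real.exp (4 / 3 * x)
      ≤ Real.exp ((Real.log 4 - 4 / 3) * x) * Real.exp (4 / 3 * x) := by
        gcongr
        linarith
    _ = (4 : ℝ) ^ x := by
        rw [← Real.exp_add, Real.rpow_def_of_pos (by norm_num)]
        ring_nf

theorem four_rpow_lt_mul_centralBinom {x : ℝ} {n : ℕ} (hn : 4 ≤ n) (hlo : x - 2 < n)
    (hhi : (n : ℝ) ≤ x) : (4 : ℝ) ^ x < 16 * x * Nat.centralBinom n := by
  have h : (4 : ℝ) ^ n < n * Nat.centralBinom n := by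
    exact_mod_cast Nat.four_pow_lt_mul_centralBinom n hn
  calc (4 : ℝ) ^ x ≤ (4 : ℝ) ^ ((n : ℝ) + 2) :=
        Real.rpow_le_rpow_of_exponent_le (by norm_num) (by linarith)
    _ = 16 * (4 : ℝ) ^ n := by
        rw [Real.rpow_add (by norm_num), Real.rpow_natCast]
        norm_num
        ring
    _ < 16 * (n * Nat.centralBinom n) := by gcongr
    _ ≤ 16 * x * Nat.centralBinom n := by
        rw [← mul_assoc]
        gcongr

/-- For every real `α > 0` there exists `N ∈ ℕ` such that for every natural `g ≥ N`, with
`k = 2⌊(1/2)((3/4) α log g − 1)⌋ + 1` and `p = ⌊4g/(3 α log g)⌋ + 2`, one has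
`(p − 1)·C(2k, k) > g^(1+α)`. -/
theorem number_of_curves_exceeds (α : ℝ) (hα : 0 < α) :
    ∃ N : ℕ, ∀ g : ℕ, N ≤ g →
      ∀ k p : ℤ,
        k = 2 * ⌊(1 / 2 : ℝ) * ((3 / 4) * α * Real.log g - 1)⌋ + 1 →
        p = ⌊4 * (g : ℝ) / (3 * α * Real.log g)⌋ + 2 →
        ((p : ℝ) - 1) * (Nat.centralBinom k.toNat : ℝ) > (g : ℝ) ^ (1 + α) := by
  have htend : Filter.Tendsto (fun g : ℕ => 3 / 4 * α * Real.log g) Filter.atTop Filter.atTop :=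
    (Real.tendsto_log_atTop.comp tendsto_natCast_atTop_atTop).const_mul_atTop (by positivity)
  obtain ⟨N, hN⟩ := Filter.eventually_atTop.1
    (((htend.eventually eventually_sq_mul_exp_le_four_rpow).and
      (htend.eventually_ge_atTop 7)).and (Filter.eventually_gt_atTop 0))
  refine ⟨N, fun g hg k p hk hp => ?_⟩
  obtain ⟨⟨hexp, hx⟩, hgpos⟩ := hN g hg
  have hg0 : (0 : ℝ) < g := by exact_mod_cast hgpos
  have hpow : (g : ℝ) ^ (1 + α) = g * Real.exp (4 / 3 * (3 / 4 * α * Real.log g)) := by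
    rw [Real.rpow_add hg0, Real.rpow_one, Real.rpow_def_of_pos hg0]
    ring_nf
  have hdiv : 4 * (g : ℝ) / (3 * α * Real.log g) = g / (3 / 4 * α * Real.log g) := by
    rw [show 3 * α * Real.log g = 4 * (3 / 4 * α * Real.log g) by ring,
      mul_div_mul_left _ _ (by norm_num)]
  rw [hdiv] at hp
  rw [hpow]
  generalize 3 / 4 * α * Real.log g = x at *
  have hx0 : 0 < x := by linarith
  have hkR : (k : ℝ) = 2 * (⌊(1 / 2 : ℝ) * (x - 1)⌋ : ℝ) + 1 := by rw [hk]; push_cast; ring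
  have hlo : x - 2 < k := by linarith [Int.lt_floor_add_one ((1 / 2 : ℝ) * (x - 1))]
  have hhi : (k : ℝ) ≤ x := by linarith [Int.floor_le ((1 / 2 : ℝ) * (x - 1))]
  have hk4 : 4 ≤ k := by
    have : (4 : ℝ) < k := by linarith
    exact_mod_cast this.le
  have hcast : ((k.toNat : ℕ) : ℝ) = k := by
    exact_mod_cast Int.toNat_of_nonneg (by lia : 0 ≤ k)
  have hbinom := four_rpow_lt_mul_centralBinom (x := x) (n := k.toNat) (by lia)
    (by rwa [hcast]) (by rwa [hcast])
  have hpR : g / x < (p : ℝ) - 1 := by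
    rw [hp]
    push_cast
    linarith [Int.lt_floor_add_one ((g : ℝ) / x)]
  have hB : x * Real.exp (4 / 3 * x) < Nat.centralBinom k.toNat := by
    refine lt_of_mul_lt_mul_left ?_ (by positivity : 0 ≤ 16 * x)
    linarith
  calc (g : ℝ) * Real.exp (4 / 3 * x) = g / x * (x * Real.exp (4 / 3 * x)) := by field_simp
    _ < g / x * Nat.centralBinom k.toNat := by gcongr
    _ ≤ ((p : ℝ) - 1) * Nat.centralBinom k.toNat := by gcongr
end

section
/- For every real α > 0 there exists N ∈ ℕ such that for every natural number g ≥ N the following holds. Set k = 2·⌊(1/2)·((3/4)·α·log(g) − 1)⌋ + 1, p = ⌊4g/(3·α·log(g))⌋ + 2, M = (p − 1)·C(2k, k), and m = ⌊g^{1+α}⌋. Then (m·(m − 1)·M/(M − 1)) · (4k/(p − 1)) ≤ (9/4)·α²·g^{1+2α}·(log g)², as real numbers. -/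
open Real

/-- The largest odd integer at most `x` lies in `(x - 2, x]`. -/
theorem two_mul_floor_add_one_mem_Ioc (x : ℝ) :
    ((2 * ⌊(1 / 2 : ℝ) * (x - 1)⌋ + 1 : ℤ) : ℝ) ∈ Set.Ioc (x - 2) x := by
  have h1 := Int.floor_le ((1 / 2 : ℝ) * (x - 1))
  have h2 := Int.lt_floor_add_one ((1 / 2 : ℝ) * (x - 1))
  push_cast
  constructor <;> linarith

/-- Central binomial coefficients of indices in `(x - 2, x]` dominate `x * exp (4 * x / 3)`,
since `4 / 3 < log 4`. -/
theorem eventually_mul_exp_le_centralBinom :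
    ∀ᶠ x : ℝ in Filter.atTop, ∀ n : ℕ, (n : ℝ) ∈ Set.Ioc (x - 2) x →
      x * exp (4 * x / 3) ≤ (n.centralBinom : ℝ) := by
  have hlo := (isLittleO_pow_exp_pos_mul_atTop 2 (b := 1 / 20) (by norm_num)).bound
    (c := 1 / 32) (by norm_num)
  filter_upwards [hlo, Filter.eventually_ge_atTop 2] with x hx hx2 n hn
  obtain ⟨hn1, hn2⟩ := hn
  have hn0 : 0 < n := by
    have : (0 : ℝ) < n := by linarith
    exact_mod_cast this
  have hC : (4 : ℝ) ^ n ≤ 2 * n * n.centralBinom := by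
    exact_mod_cast Nat.four_pow_le_two_mul_self_mul_centralBinom n hn0
  rw [norm_of_nonneg (by positivity), norm_of_nonneg (by positivity)] at hx
  have hlog := log_two_gt_d9
  have hpow : exp (4 * x / 3) * exp (1 / 20 * x) ≤ 16 * (4 : ℝ) ^ n := by
    have h4 : (16 : ℝ) * 4 ^ n = exp ((2 * n + 4) * log 2) := by
      rw [mul_comm, ← log_rpow two_pos, exp_log (by positivity), rpow_add two_pos, rpow_mul two_pos.le]
      norm_num
    rw [h4, ← exp_add, exp_le_exp]
    nlinarith
  have hC' : (4 : ℝ) ^ n ≤ 2 * x * n.centralBinom := hC.trans (by gcongr)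
  have hE := exp_pos (4 * x / 3)
  have key : (32 * x) * (x * exp (4 * x / 3)) ≤ (32 * x) * n.centralBinom := by
    nlinarith [mul_le_mul_of_nonneg_left hx hE.le]
  exact le_of_mul_le_mul_left key (by positivity)

/-- Passing to an averaged subsystem of size `m ≤ M` costs at most a factor making
`m * (m - 1)` into `m ^ 2`. -/
theorem mul_sub_one_mul_div_sub_one_le_sq {m M : ℝ} (hm : 0 ≤ m) (hmM : m ≤ M) (hM : 1 < M) :
    m * (m - 1) * M / (M - 1) ≤ m ^ 2 := by
  rw [div_le_iff₀ (by linarith)]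
  nlinarith [mul_nonneg hm (sub_nonneg.2 hmM)]

/-- For every real `α > 0` there exists `N ∈ ℕ` such that for every natural `g ≥ N`, with
`k = 2⌊(1/2)((3/4) α log g − 1)⌋ + 1`, `p = ⌊4g/(3 α log g)⌋ + 2`,
`M = (p − 1)·C(2k, k)` and `m = ⌊g^(1+α)⌋`, one has
`(m(m − 1)M/(M − 1)) · (4k/(p − 1)) ≤ (9/4) α² g^(1+2α) (log g)²`. -/
theorem crossing_upper_bound (α : ℝ) (hα : 0 < α) :
    ∃ N : ℕ, ∀ g : ℕ, N ≤ g →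
      ∀ k p : ℤ,
        k = 2 * ⌊(1 / 2 : ℝ) * ((3 / 4) * α * Real.log g - 1)⌋ + 1 →
        p = ⌊4 * (g : ℝ) / (3 * α * Real.log g)⌋ + 2 →
        ∀ M : ℝ, M = ((p : ℝ) - 1) * (Nat.centralBinom k.toNat : ℝ) →
        ∀ m : ℤ, m = ⌊(g : ℝ) ^ (1 + α)⌋ →
          ((m : ℝ) * ((m : ℝ) - 1) * M / (M - 1)) * (4 * (k : ℝ) / ((p : ℝ) - 1)) ≤
            (9 / 4) * α ^ 2 * (g : ℝ) ^ (1 + 2 * α) * (Real.log g) ^ 2 := by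
  have htend : Filter.Tendsto (fun g : ℕ => 3 / 4 * α * log g) Filter.atTop Filter.atTop :=
    (tendsto_log_atTop.comp tendsto_natCast_atTop_atTop).const_mul_atTop (by positivity)
  obtain ⟨N, hN⟩ := Filter.eventually_atTop.1
    ((htend.eventually eventually_mul_exp_le_centralBinom).and
      ((htend.eventually_ge_atTop 2).and (Filter.eventually_ge_atTop 2)))
  refine ⟨N, fun g hg k p hk hp M hM m hm => ?_⟩
  obtain ⟨hC, hx2, hg2⟩ := hN g hg
  have hkx := two_mul_floor_add_one_mem_Ioc (3 / 4 * α * log g)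
  rw [← hk] at hkx
  set x := 3 / 4 * α * log g with hx
  have hx0 : 0 < x := by linarith
  have hg1 : (1 : ℝ) < g := by exact_mod_cast hg2
  have hg0 : (0 : ℝ) < g := by linarith
  have hk0 : (0 : ℝ) < k := by linarith [hkx.1]
  have hkn : ((k.toNat : ℕ) : ℝ) = k := by
    exact_mod_cast Int.toNat_of_nonneg (by exact_mod_cast hk0.le : 0 ≤ k)
  have hbin := hC k.toNat (by rwa [hkn])
  have hgα : exp (4 * x / 3) = (g : ℝ) ^ α := by
    rw [rpow_def_of_pos hg0, hx]
    ring_nf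
  rw [hgα] at hbin
  have hp1 : g / x < (p : ℝ) - 1 := by
    have hdiv : 4 * (g : ℝ) / (3 * α * log g) = g / x := by
      rw [show 3 * α * log g = 4 * x by rw [hx]; ring, mul_div_mul_left _ _ four_ne_zero]
    have := Int.lt_floor_add_one ((g : ℝ) / x)
    rw [hp, hdiv]
    push_cast
    linarith
  have hMge : (g : ℝ) ^ (1 + α) ≤ M := by
    calc (g : ℝ) ^ (1 + α) = g / x * (x * (g : ℝ) ^ α) := by
          rw [rpow_add hg0, rpow_one]
          field_simp
      _ ≤ M := by
          rw [hM]
          gcongr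
          exact (div_pos hg0 hx0).le.trans hp1.le
  have hmle : (m : ℝ) ≤ (g : ℝ) ^ (1 + α) := hm ▸ Int.floor_le _
  have hm0 : (0 : ℝ) ≤ m := by
    rw [hm]
    exact_mod_cast Int.floor_nonneg.2 (by positivity)
  have hM1 : 1 < M := (one_lt_rpow hg1 (by linarith)).trans_le hMge
  have hsq := mul_sub_one_mul_div_sub_one_le_sq hm0 (hmle.trans hMge) hM1
  have hfrac : 4 * (k : ℝ) / ((p : ℝ) - 1) ≤ 4 * x / (g / x) := by
    gcongr
    exact hkx.2
  have hfrac0 : 0 ≤ 4 * (k : ℝ) / ((p : ℝ) - 1) :=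
    div_nonneg (by positivity) ((div_pos hg0 hx0).le.trans hp1.le)
  calc _ ≤ (m : ℝ) ^ 2 * (4 * (k : ℝ) / ((p : ℝ) - 1)) := by gcongr
    _ ≤ ((g : ℝ) ^ (1 + α)) ^ 2 * (4 * x / (g / x)) := by gcongr
    _ = (9 / 4) * α ^ 2 * (g : ℝ) ^ (1 + 2 * α) * (log g) ^ 2 := by
      have h : ((g : ℝ) ^ (1 + α)) ^ 2 = g * (g : ℝ) ^ (1 + 2 * α) := by
        rw [← rpow_mul_natCast hg0.le, ← rpow_one_add' hg0.le (by positivity)]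
        congr 1
        push_cast
        ring
      rw [h, hx]
      field_simp
      ring
end
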